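/- For an ordered partition P = (S_1,…,S_r) of {1,…,d} and a nonempty S ⊆ {1,…,d}, let i(S,P) = max{j : S ⊆ S_j ∪ S_{j+1} ∪ … ∪ S_r}, and let Z(P) = {w ∈ B : for every nonempty S ⊆ {1,…,d}, {n : w^S_n ≠ 0} = S ∩ S_{i(S,P)}}. Then for any two ordered partitions P and P′ of {1,…,d}: the closure of Z(P) in Π_{∅≠S⊆{1,…,d}} ℝ^d is contained in the closure of Z(P′) if and only if P ⪯ P′. -/

import Mathlib

noncomputable section
open Polynomial Filter Topology ENNReal

/-- The inner product `⟨p,q⟩_v = ∑ₖ p(μₖ)q(μₖ)vₖ`. -/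
def ip {m : ℕ} (μ v : Fin m → ℝ) (p q : ℝ[X]) : ℝ :=
  ∑ k, p.eval (μ k) * q.eval (μ k) * v k

/-- Pair `(pₙ, pₙ₋₁)` of monic orthogonal polynomials (with `p₋₁ = 0`). -/
def opAux {m : ℕ} (μ v : Fin m → ℝ) : ℕ → ℝ[X] × ℝ[X]
  | 0 => (1, 0)
  | n + 1 =>
    let P := opAux μ v n
    ((X - C (ip μ v P.1 (X * P.1) / ip μ v P.1 P.1)) * P.1
        - C (ip μ v P.1 P.1 / ip μ v P.2 P.2) * P.2, P.1)

/-- The `n`-th monic orthogonal polynomial of the recursion. -/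
def op {m : ℕ} (μ v : Fin m → ℝ) (n : ℕ) : ℝ[X] := (opAux μ v n).1

/-- The entry `a_N` of the Jacobi matrix construction: for odd `N = 2n+1` the diagonal
entry `a_{2n+1} = ⟨pₙ, Xpₙ⟩/⟨pₙ,pₙ⟩`, for even `N = 2n` the off-diagonal entry
`a_{2n} = √(⟨pₙ,pₙ⟩/⟨pₙ₋₁,pₙ₋₁⟩)`. -/
def fEnt {m : ℕ} (μ v : Fin m → ℝ) (N : ℕ) : ℝ :=
  if N % 2 = 1 then
    ip μ v (op μ v (N / 2)) (X * op μ v (N / 2)) / ip μ v (op μ v (N / 2)) (op μ v (N / 2))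
  else
    Real.sqrt (ip μ v (op μ v (N / 2)) (op μ v (N / 2)) /
      ip μ v (op μ v (N / 2 - 1)) (op μ v (N / 2 - 1)))

/-- The symmetric tridiagonal matrix `f(μ, v)` with diagonal `a₁,a₃,…` and
sub/super-diagonal `a₂,a₄,…`. -/
def Jmat {m : ℕ} (μ v : Fin m → ℝ) : Matrix (Fin m) (Fin m) ℝ :=
  Matrix.of fun i j =>
    if i = j then fEnt μ v (2 * (i : ℕ) + 1)
    else if (i : ℕ) + 1 = (j : ℕ) ∨ (j : ℕ) + 1 = (i : ℕ) then fEnt μ v ((i : ℕ) + (j : ℕ) + 1)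
    else 0

/-- Restriction of `g : Fin d → ℝ` to a subset `Q`, reindexed in increasing order. -/
def restr {d : ℕ} (Q : Finset (Fin d)) (g : Fin d → ℝ) : Fin Q.card → ℝ :=
  fun k => g ((Q.orderIsoOfFin rfl) k).1

/-- Leading `i × i` principal submatrix. -/
def leadSub {d : ℕ} (J : Matrix (Fin d) (Fin d) ℝ) (i : ℕ) (h : i ≤ d) :
    Matrix (Fin i) (Fin i) ℝ :=
  Matrix.of fun a b => J ⟨a.1, lt_of_lt_of_le a.2 h⟩ ⟨b.1, lt_of_lt_of_le b.2 h⟩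

/-- A sequence of positive weight vectors is stable if all pairwise ratios converge
in `[0,∞]`. -/
def Stable {d : ℕ} (w : ℕ → Fin d → ℝ) : Prop :=
  (∀ n i, 0 < w n i) ∧
    ∀ i j : Fin d, ∃ L : ℝ≥0∞,
      Tendsto (fun n => ENNReal.ofReal (w n i / w n j)) atTop (𝓝 L)

/-- `S : Fin r → Finset (Fin d)` is an ordered partition of `{0,…,d-1}`. -/
def OrdPart {d r : ℕ} (S : Fin r → Finset (Fin d)) : Prop :=
  (∀ j, (S j).Nonempty) ∧ (∀ j k, j ≠ k → Disjoint (S j) (S k)) ∧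
    Finset.univ.biUnion S = (Finset.univ : Finset (Fin d))

/-- `S` is the limiting partition of the stable sequence `w`. -/
def LimPart {d r : ℕ} (w : ℕ → Fin d → ℝ) (S : Fin r → Finset (Fin d)) : Prop :=
  OrdPart S ∧
  (∀ i j : Fin d, (∃ a, i ∈ S a ∧ j ∈ S a) ↔
      ∃ L : ℝ, 0 < L ∧ Tendsto (fun n => w n i / w n j) atTop (𝓝 L)) ∧
  (∀ a b : Fin r, a < b → ∀ i ∈ S a, ∀ j ∈ S b,
      Tendsto (fun n => w n i / w n j) atTop atTop)

/-- The constant `C_i^T = ∏_{t ∈ T} (λ_t − λ_i)²`. -/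
def Cc {d : ℕ} (lam : Fin d → ℝ) (i : Fin d) (T : Finset (Fin d)) : ℝ :=
  ∏ t ∈ T, (lam t - lam i) ^ 2

/-- Offset `∑_{k<j} |S_k|` of the `j`-th block. -/
def offS {d r : ℕ} (S : Fin r → Finset (Fin d)) (j : Fin r) : ℕ :=
  ∑ k ∈ Finset.univ.filter (· < j), (S k).card

/-- The block-diagonal matrix whose `j`-th block (in rows/columns
`offS S j, …, offS S j + |S_j| - 1`) is `Jmat (restr (S j) lam) (restr (S j) (v j))`. -/
def blockDiag {d r : ℕ} (lam : Fin d → ℝ) (S : Fin r → Finset (Fin d))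
    (v : Fin r → Fin d → ℝ) : Matrix (Fin d) (Fin d) ℝ :=
  Matrix.of fun p q =>
    ∑ j : Fin r,
      if h : offS S j ≤ (p : ℕ) ∧ (p : ℕ) < offS S j + (S j).card ∧
          offS S j ≤ (q : ℕ) ∧ (q : ℕ) < offS S j + (S j).card then
        Jmat (restr (S j) lam) (restr (S j) (v j))
          ⟨(p : ℕ) - offS S j, by omega⟩ ⟨(q : ℕ) - offS S j, by omega⟩
      else 0

/-- Nonempty subsets of `Fin d`. -/
abbrev NES (d : ℕ) := {S : Finset (Fin d) // S.Nonempty}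

/-- The ambient Euclidean space of families `(w^S)` indexed by nonempty subsets. -/
abbrev Ew (d : ℕ) := NES d → Fin d → ℝ

/-- The blow-up `B` (normalized representatives): support, nonnegativity,
normalization, and the quadratic equations. -/
def Bset {d : ℕ} (lam : Fin d → ℝ) : Set (Ew d) :=
  {w | (∀ S : NES d, ∀ n, n ∉ S.1 → w S n = 0) ∧
    (∀ S n, 0 ≤ w S n) ∧
    (∀ S : NES d, ∑ n ∈ S.1, w S n = 1) ∧
    ∀ R S : NES d, R.1 ⊆ S.1 → ∀ i ∈ R.1, ∀ j ∈ R.1,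
      Cc lam i (S.1 \ R.1) * w R j * w S i = Cc lam j (S.1 \ R.1) * w R i * w S j}

/-- `𝒥̄^Λ`: symmetric tridiagonal matrices with nonnegative off-diagonal entries and
characteristic polynomial `∏ (X − λ_k)`. -/
def Jset {d : ℕ} (lam : Fin d → ℝ) : Set (Matrix (Fin d) (Fin d) ℝ) :=
  {J | (∀ i j, J i j = J j i) ∧
    (∀ i j : Fin d, (i : ℕ) + 2 ≤ (j : ℕ) ∨ (j : ℕ) + 2 ≤ (i : ℕ) → J i j = 0) ∧
    (∀ i j : Fin d, (i : ℕ) + 1 = (j : ℕ) → 0 ≤ J i j) ∧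
    J.charpoly = ∏ k, (X - C (lam k))}

/-- `K_j = S_j ∪ S_{j+1} ∪ … ∪ S_r`. -/
def Kof {d r : ℕ} (S : Fin r → Finset (Fin d)) (j : Fin r) : Finset (Fin d) :=
  (Finset.univ.filter (j ≤ ·)).biUnion S

/-- The piece `Z(P)` of `B` corresponding to the ordered partition `P = (S_1,…,S_r)`:
for every nonempty `T`, the support of `w^T` is `T ∩ S_{i(T,P)}`. -/
def Zset {d : ℕ} (lam : Fin d → ℝ) {r : ℕ} (S : Fin r → Finset (Fin d)) : Set (Ew d) :=
  {w | w ∈ Bset lam ∧ ∀ T : NES d, ∃ j : Fin r, T.1 ⊆ Kof S j ∧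
    (∀ k, T.1 ⊆ Kof S k → k ≤ j) ∧ ∀ n : Fin d, w T n ≠ 0 ↔ n ∈ T.1 ∧ n ∈ S j}

/-- `R ⪯ S`: the ordered partition `R` refines `S`, i.e. `R` is the concatenation of
ordered partitions of `S_1`, then `S_2`, etc. -/
def Refines {d q r : ℕ} (R : Fin q → Finset (Fin d)) (S : Fin r → Finset (Fin d)) : Prop :=
  ∃ b : Fin (r + 1) → ℕ, b 0 = 0 ∧ b (Fin.last r) = q ∧
    (∀ i j : Fin (r + 1), i ≤ j → b i ≤ b j) ∧
    ∀ i : Fin r, S i = (Finset.univ.filter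
      (fun k : Fin q => b i.castSucc ≤ (k : ℕ) ∧ (k : ℕ) < b i.succ)).biUnion R

/-- The `j`-th consecutive interval `I_j(T)` of lengths `|T_1|,…,|T_r|`. -/
def Iint {d r : ℕ} (T : Fin r → Finset (Fin d)) (j : Fin r) : Finset (Fin d) :=
  Finset.univ.filter (fun m : Fin d => offS T j ≤ (m : ℕ) ∧ (m : ℕ) < offS T j + (T j).card)

/-- `H(T) = {σ : σ(T_j) = I_j(T) for all j}`. -/
def Hset {d r : ℕ} (T : Fin r → Finset (Fin d)) : Set (Equiv.Perm (Fin d)) :=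
  {σ | ∀ j, (T j).image σ = Iint T j}

/-- Interval Young subgroups: setwise stabilizers of a division of `{0,…,d-1}` into
consecutive intervals. -/
def IsIntervalYoung {d : ℕ} (G : Set (Equiv.Perm (Fin d))) : Prop :=
  ∃ (q : ℕ) (c : Fin q → Finset (Fin d)), OrdPart c ∧ (∀ j : Fin q, c j = Iint c j) ∧
    G = {τ : Equiv.Perm (Fin d) | ∀ j, (c j).image ⇑τ = c j}

/-- Number of surjections from an `a`-element set onto a `b`-element set. -/
def Surj (a b : ℕ) : ℕ := Fintype.card {f : Fin a → Fin b // Function.Surjective f}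

/-- The Euler characteristic `χ_d = ∑_{q=1}^d (−2)^{d−q}·Surj(d,q)`. -/
def chi (a : ℕ) : ℝ := ∑ q ∈ Finset.Icc 1 a, (-2 : ℝ) ^ (a - q) * (Surj a q : ℝ)

/-- The elements of `T` on which `ρ` is minimal. -/
def argminOn {d r : ℕ} (ρ : Fin d → Fin r) (T : Finset (Fin d)) : Finset (Fin d) :=
  T.filter fun n => ∀ m ∈ T, ρ n ≤ ρ m

/-- The family in `Bset lam` with positive weights `u`, where `w^T` is concentrated on
the minimizers of `ρ` on `T`. -/
def weightFamily {d r : ℕ} (lam u : Fin d → ℝ) (ρ : Fin d → Fin r) : Ew d := fun T n =>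
  if n ∈ argminOn ρ T.1 then
    u n * Cc lam n (T.1)ᶜ / ∑ m ∈ argminOn ρ T.1, u m * Cc lam m (T.1)ᶜ
  else 0

section argminOn

variable {d r : ℕ} {ρ : Fin d → Fin r} {T : Finset (Fin d)}

theorem mem_argminOn {n : Fin d} : n ∈ argminOn ρ T ↔ n ∈ T ∧ ∀ m ∈ T, ρ n ≤ ρ m := by
  simp [argminOn]

theorem argminOn_nonempty (ρ : Fin d → Fin r) (hT : T.Nonempty) : (argminOn ρ T).Nonempty := by
  obtain ⟨n, hn, h⟩ := T.exists_min_image ρ hT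
  exact ⟨n, mem_argminOn.2 ⟨hn, h⟩⟩

theorem argminOn_subset_argminOn {r' : ℕ} {ρ' : Fin d → Fin r'}
    (h : ∀ i j, ρ i ≤ ρ j → ρ' i ≤ ρ' j) (T : Finset (Fin d)) :
    argminOn ρ T ⊆ argminOn ρ' T := by
  intro n hn
  rw [mem_argminOn] at hn ⊢
  exact ⟨hn.1, fun m hm => h _ _ (hn.2 m hm)⟩

/-- If `S` has a `ρ`-minimizer in `R ⊆ S`, the minimizers on `R` are those on `S` lying in `R`. -/
theorem mem_argminOn_iff_of_subset {R S : Finset (Fin d)} (hRS : R ⊆ S) {i j : Fin d}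
    (hi : i ∈ R) (hiS : i ∈ argminOn ρ S) (hj : j ∈ R) :
    j ∈ argminOn ρ R ↔ j ∈ argminOn ρ S := by
  simp only [mem_argminOn] at hiS ⊢
  constructor
  · rintro ⟨_, h⟩
    exact ⟨hRS hj, fun m hm => (h i hi).trans (hiS.2 m hm)⟩
  · rintro ⟨_, h⟩
    exact ⟨hj, fun m hm => h m (hRS hm)⟩

end argminOn

theorem Cc_pos {d : ℕ} {lam : Fin d → ℝ} (hlam : Function.Injective lam) {i : Fin d}
    {T : Finset (Fin d)} (hi : i ∉ T) : 0 < Cc lam i T := by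
  refine Finset.prod_pos fun t ht => ?_
  have h : lam t - lam i ≠ 0 := sub_ne_zero.2 fun h => hi (hlam h ▸ ht)
  positivity

theorem Cc_sdiff_mul_Cc_compl {d : ℕ} (lam : Fin d → ℝ) (i : Fin d) {R S : Finset (Fin d)}
    (h : R ⊆ S) : Cc lam i (S \ R) * Cc lam i Sᶜ = Cc lam i Rᶜ := by
  unfold Cc
  rw [← Finset.prod_union]
  · congr 1
    ext t
    have := @h t
    simp only [Finset.mem_union, Finset.mem_sdiff, Finset.mem_compl]
    tauto
  · rw [Finset.disjoint_left]
    intro t ht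
    simp only [Finset.mem_sdiff, Finset.mem_compl] at ht ⊢
    tauto

theorem OrdPart.exists_index {d r : ℕ} {S : Fin r → Finset (Fin d)} (hS : OrdPart S) :
    ∃ ρ : Fin d → Fin r, ∀ n j, n ∈ S j ↔ ρ n = j := by
  obtain ⟨_, hdisj, hcover⟩ := hS
  have h : ∀ n, ∃ j, n ∈ S j := fun n => by
    have := Finset.mem_univ n
    rw [← hcover] at this
    simpa using this
  choose ρ hρ using h
  refine ⟨ρ, fun n j => ⟨fun hn => ?_, fun hn => hn ▸ hρ n⟩⟩
  by_contra hne
  exact Finset.disjoint_left.1 (hdisj _ _ hne) (hρ n) hn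

theorem mem_Kof {d r : ℕ} {S : Fin r → Finset (Fin d)} {ρ : Fin d → Fin r}
    (hρ : ∀ n j, n ∈ S j ↔ ρ n = j) {n : Fin d} {j : Fin r} : n ∈ Kof S j ↔ j ≤ ρ n := by
  simp [Kof, hρ]

theorem mem_Zset_iff {d r : ℕ} {lam : Fin d → ℝ} {S : Fin r → Finset (Fin d)}
    {ρ : Fin d → Fin r} (hρ : ∀ n j, n ∈ S j ↔ ρ n = j) {w : Ew d} :
    w ∈ Zset lam S ↔ w ∈ Bset lam ∧ ∀ T : NES d, ∀ n, w T n ≠ 0 ↔ n ∈ argminOn ρ T.1 := by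
  have key (T : NES d) (j : Fin r) (hj : T.1 ⊆ Kof S j) (hmax : ∀ k, T.1 ⊆ Kof S k → k ≤ j)
      (n : Fin d) : n ∈ T.1 ∧ n ∈ S j ↔ n ∈ argminOn ρ T.1 := by
    rw [mem_argminOn, hρ]
    refine and_congr_right fun hn => ⟨?_, fun h => ?_⟩
    · rintro rfl m hm
      exact (mem_Kof hρ).1 (hj hm)
    · exact le_antisymm (hmax _ fun m hm => (mem_Kof hρ).2 (h m hm)) ((mem_Kof hρ).1 (hj hn))
  refine and_congr_right fun _ => forall_congr' fun T => ⟨?_, fun h => ?_⟩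
  · rintro ⟨j, hj, hmax, h⟩ n
    rw [h, key T j hj hmax]
  · obtain ⟨n, hn⟩ := argminOn_nonempty ρ T.2
    rw [mem_argminOn] at hn
    have hj : T.1 ⊆ Kof S (ρ n) := fun m hm => (mem_Kof hρ).2 (hn.2 m hm)
    have hmax : ∀ k, T.1 ⊆ Kof S k → k ≤ ρ n := fun k hk => (mem_Kof hρ).1 (hk hn.1)
    exact ⟨ρ n, hj, hmax, fun m => by rw [h, key T _ hj hmax]⟩

section weightFamily

variable {d r : ℕ} {lam u : Fin d → ℝ} {ρ : Fin d → Fin r}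

theorem mul_Cc_pos (hlam : Function.Injective lam) (hu : ∀ n, 0 < u n) {T : Finset (Fin d)}
    {n : Fin d} (hn : n ∈ T) : 0 < u n * Cc lam n Tᶜ :=
  mul_pos (hu n) (Cc_pos hlam (by simpa using hn))

theorem sum_argminOn_pos (hlam : Function.Injective lam) (hu : ∀ n, 0 < u n)
    (ρ : Fin d → Fin r) (T : NES d) : 0 < ∑ m ∈ argminOn ρ T.1, u m * Cc lam m (T.1)ᶜ :=
  Finset.sum_pos (fun _ hm => mul_Cc_pos hlam hu (mem_argminOn.1 hm).1)
    (argminOn_nonempty ρ T.2)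

theorem weightFamily_ne_zero_iff (hlam : Function.Injective lam) (hu : ∀ n, 0 < u n)
    (T : NES d) (n : Fin d) : weightFamily lam u ρ T n ≠ 0 ↔ n ∈ argminOn ρ T.1 := by
  unfold weightFamily
  split_ifs with h
  · simpa only [h, iff_true] using
      (div_pos (mul_Cc_pos hlam hu (mem_argminOn.1 h).1) (sum_argminOn_pos hlam hu ρ T)).ne'
  · simp [h]

theorem weightFamily_mem_Bset (hlam : Function.Injective lam) (hu : ∀ n, 0 < u n) :
    weightFamily lam u ρ ∈ Bset lam := by
  refine ⟨fun T n hn => ?_, fun T n => ?_, fun T => ?_, fun R S hRS i hi j hj => ?_⟩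
  · by_contra h
    exact hn (mem_argminOn.1 ((weightFamily_ne_zero_iff hlam hu T n).1 h)).1
  · unfold weightFamily
    split_ifs with h
    · exact (div_pos (mul_Cc_pos hlam hu (mem_argminOn.1 h).1)
        (sum_argminOn_pos hlam hu ρ T)).le
    · exact le_rfl
  · have hsub : argminOn ρ T.1 ⊆ T.1 := Finset.filter_subset _ _
    simp only [weightFamily]
    rw [← Finset.sum_filter, Finset.filter_mem_eq_inter, Finset.inter_eq_right.2 hsub,
      ← Finset.sum_div, div_self (sum_argminOn_pos hlam hu ρ T).ne']
  · by_cases hiS : i ∈ argminOn ρ S.1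
    · have hj' := mem_argminOn_iff_of_subset hRS hi hiS hj
      have hiR := (mem_argminOn_iff_of_subset hRS hi hiS hi).2 hiS
      by_cases hjS : j ∈ argminOn ρ S.1
      · simp only [weightFamily, hiS, hjS, hiR, hj'.2 hjS, if_true,
          ← Cc_sdiff_mul_Cc_compl lam i hRS, ← Cc_sdiff_mul_Cc_compl lam j hRS]
        ring
      · have hjR : j ∉ argminOn ρ R.1 := fun h => hjS (hj'.1 h)
        simp [weightFamily, hjS, hjR]
    · by_cases hjS : j ∈ argminOn ρ S.1
      · have hiR : i ∉ argminOn ρ R.1 := fun h =>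
          hiS ((mem_argminOn_iff_of_subset hRS hj hjS hi).1 h)
        simp [weightFamily, hiS, hiR]
      · simp [weightFamily, hiS, hjS]

theorem weightFamily_mem_Zset {S : Fin r → Finset (Fin d)} (hρ : ∀ n j, n ∈ S j ↔ ρ n = j)
    (hlam : Function.Injective lam) (hu : ∀ n, 0 < u n) : weightFamily lam u ρ ∈ Zset lam S :=
  (mem_Zset_iff hρ).2 ⟨weightFamily_mem_Bset hlam hu, weightFamily_ne_zero_iff hlam hu⟩

/-- Every point of `Zset lam S` is given by positive weights. -/
theorem exists_eq_weightFamily {S : Fin r → Finset (Fin d)} (hρ : ∀ n j, n ∈ S j ↔ ρ n = j)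
    (hlam : Function.Injective lam) {w : Ew d} (hw : w ∈ Zset lam S) :
    ∃ u : Fin d → ℝ, (∀ n, 0 < u n) ∧ w = weightFamily lam u ρ := by
  obtain ⟨⟨hsupp, hnonneg, hsum, heq⟩, hne⟩ := (mem_Zset_iff hρ).1 hw
  let K : Fin d → NES d := fun n => ⟨Finset.univ.filter fun m => ρ n ≤ ρ m, n, by simp⟩
  have hK : ∀ {n m}, m ∈ (K n).1 ↔ ρ n ≤ ρ m := by simp [K]
  have hCK : ∀ n, 0 < Cc lam n ((K n).1)ᶜ := fun n => Cc_pos hlam (by simp [K])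
  have hwK : ∀ n, 0 < w (K n) n := fun n =>
    (hnonneg _ _).lt_of_ne' ((hne _ _).2 (mem_argminOn.2 ⟨hK.2 le_rfl, fun m hm => hK.1 hm⟩))
  let u : Fin d → ℝ := fun n => w (K n) n / Cc lam n ((K n).1)ᶜ
  have hu : ∀ n, 0 < u n := fun n => div_pos (hwK n) (hCK n)
  have huK : ∀ n, w (K n) n = u n * Cc lam n ((K n).1)ᶜ := fun n =>
    (div_mul_cancel₀ _ (hCK n).ne').symm
  refine ⟨u, hu, ?_⟩
  funext T i
  by_cases hi : i ∈ argminOn ρ T.1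
  · have hi' := mem_argminOn.1 hi
    have hTK : T.1 ⊆ (K i).1 := fun m hm => hK.2 (hi'.2 m hm)
    have hprop : ∀ m ∈ argminOn ρ T.1,
        w T i * (u m * Cc lam m (T.1)ᶜ) = u i * Cc lam i (T.1)ᶜ * w T m := by
      intro m hm
      have hm' := mem_argminOn.1 hm
      have hρm : ρ m = ρ i := le_antisymm (hm'.2 i hi'.1) (hi'.2 m hm'.1)
      have hKm : K m = K i := by simp [K, hρm]
      have h := heq T (K i) hTK i hi'.1 m hm'.1
      rw [huK i, ← hKm, huK m, hKm] at h
      rw [← Cc_sdiff_mul_Cc_compl lam i hTK, ← Cc_sdiff_mul_Cc_compl lam m hTK]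
      linear_combination -h
    have hsum' : ∑ m ∈ argminOn ρ T.1, w T m = 1 := by
      rw [← hsum T]
      refine Finset.sum_subset (Finset.filter_subset _ _) fun m _ hm => ?_
      by_contra h
      exact hm ((hne T m).1 h)
    rw [weightFamily, if_pos hi, eq_div_iff (sum_argminOn_pos hlam hu ρ T).ne', Finset.mul_sum,
      Finset.sum_congr rfl hprop, ← Finset.mul_sum, hsum', mul_one]
  · rw [weightFamily, if_neg hi]
    by_contra h
    exact hi ((hne T i).1 h)

/-- Scaling the weights by powers of `ε` and letting `ε → 0` passes from a coarse ordered
partition to a finer one. -/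
theorem tendsto_weightFamily {r' : ℕ} {ρ' : Fin d → Fin r'} (hlam : Function.Injective lam)
    (hu : ∀ n, 0 < u n) (h : ∀ i j, ρ i ≤ ρ j → ρ' i ≤ ρ' j) :
    Tendsto (fun ε : ℝ => weightFamily lam (fun n => ε ^ (ρ n : ℕ) * u n) ρ') (𝓝[>] 0)
      (𝓝 (weightFamily lam u ρ)) := by
  rw [tendsto_pi_nhds]
  intro T
  rw [tendsto_pi_nhds]
  intro n
  have hsub := argminOn_subset_argminOn h T.1
  by_cases hn : n ∈ argminOn ρ' T.1
  swap
  · have hn' : n ∉ argminOn ρ T.1 := fun h => hn (hsub h)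
    simp [weightFamily, hn, hn']
  obtain ⟨a, ha⟩ := argminOn_nonempty ρ T.2
  have ha' := mem_argminOn.1 ha
  let c : Fin d → ℝ := fun m => u m * Cc lam m (T.1)ᶜ
  have hzero : ∀ m ∈ T.1, (0 : ℝ) ^ ((ρ m : ℕ) - ρ a) * c m =
      if m ∈ argminOn ρ T.1 then c m else 0 := by
    intro m hm
    have hle : (ρ a : ℕ) ≤ ρ m := ha'.2 m hm
    split_ifs with hmin
    · have : (ρ m : ℕ) ≤ ρ a := (mem_argminOn.1 hmin).2 a ha'.1
      simp [Nat.sub_eq_zero_of_le this]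
    · have : (ρ m : ℕ) - ρ a ≠ 0 := fun h0 => hmin <| mem_argminOn.2 ⟨hm, fun k hk =>
        le_trans (Fin.le_def.2 (by omega)) (ha'.2 k hk)⟩
      simp [this]
  have hden : ∑ m ∈ argminOn ρ' T.1, (0 : ℝ) ^ ((ρ m : ℕ) - ρ a) * c m =
      ∑ m ∈ argminOn ρ T.1, c m := by
    rw [Finset.sum_congr rfl fun m hm => hzero m (mem_argminOn.1 hm).1, ← Finset.sum_filter,
      Finset.filter_mem_eq_inter, Finset.inter_eq_right.2 hsub]
  have hlim : weightFamily lam u ρ T n = (0 : ℝ) ^ ((ρ n : ℕ) - ρ a) * c n /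
      ∑ m ∈ argminOn ρ' T.1, (0 : ℝ) ^ ((ρ m : ℕ) - ρ a) * c m := by
    rw [hden, hzero n (mem_argminOn.1 hn).1, weightFamily]
    split_ifs <;> simp [c]
  have hcont : ContinuousAt (fun ε : ℝ => ε ^ ((ρ n : ℕ) - ρ a) * c n /
      ∑ m ∈ argminOn ρ' T.1, ε ^ ((ρ m : ℕ) - ρ a) * c m) 0 := by
    refine ContinuousAt.div (by fun_prop) (by fun_prop) ?_
    rw [hden]
    exact (sum_argminOn_pos hlam hu ρ T).ne'
  rw [hlim]
  refine (hcont.tendsto.mono_left nhdsWithin_le_nhds).congr' ?_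
  filter_upwards [self_mem_nhdsWithin] with ε hε
  have hε : ε ^ (ρ a : ℕ) ≠ 0 := pow_ne_zero _ (ne_of_gt hε)
  have hpow : ∀ m ∈ T.1, ε ^ (ρ m : ℕ) * u m * Cc lam m (T.1)ᶜ =
      ε ^ (ρ a : ℕ) * (ε ^ ((ρ m : ℕ) - ρ a) * c m) := by
    intro m hm
    have hle : (ρ a : ℕ) ≤ ρ m := ha'.2 m hm
    rw [← mul_assoc, ← pow_add, Nat.add_sub_cancel' hle, mul_assoc]
  rw [weightFamily, if_pos hn, hpow n (mem_argminOn.1 hn).1,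
    Finset.sum_congr rfl fun m hm => hpow m (mem_argminOn.1 hm).1, ← Finset.mul_sum,
    mul_div_mul_left _ _ hε]

end weightFamily

/-- Refinement of ordered partitions, in terms of their block index functions. -/
theorem refines_iff {d q r : ℕ} {R : Fin q → Finset (Fin d)} {S : Fin r → Finset (Fin d)}
    {ρ : Fin d → Fin q} {σ : Fin d → Fin r} (hR : ∀ k, (R k).Nonempty)
    (hρ : ∀ n j, n ∈ R j ↔ ρ n = j) (hσ : ∀ n j, n ∈ S j ↔ σ n = j) :
    Refines R S ↔ ∀ i j, ρ i ≤ ρ j → σ i ≤ σ j := by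
  constructor
  · rintro ⟨b, -, -, hmono, hb⟩ i j hij
    have hmem (n : Fin d) : b (σ n).castSucc ≤ (ρ n : ℕ) ∧ (ρ n : ℕ) < b (σ n).succ := by
      have h := (hσ n _).2 rfl
      rw [hb] at h
      simpa [hρ] using h
    by_contra! hlt
    have h₁ := hmono (σ j).succ (σ i).castSucc (by
      rw [Fin.le_def, Fin.val_succ, Fin.val_castSucc]
      exact hlt)
    have h₂ := (hmem i).1
    have h₃ := (hmem j).2
    rw [Fin.le_def] at hij
    omega
  · intro h
    choose e he using hR
    have hρe : ∀ k, ρ (e k) = k := fun k => (hρ _ _).1 (he k)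
    have hσe : ∀ n, σ (e (ρ n)) = σ n := fun n =>
      le_antisymm (h _ _ (hρe _).le) (h _ _ (hρe _).ge)
    have hmono : ∀ k l, k ≤ l → σ (e k) ≤ σ (e l) := fun k l hkl =>
      h _ _ (by simpa only [hρe] using hkl)
    let F : ℕ → Finset (Fin q) := fun i => Finset.univ.filter fun k => (σ (e k) : ℕ) < i
    have hF : ∀ i (k : Fin q), (k : ℕ) < (F i).card ↔ (σ (e k) : ℕ) < i := by
      intro i k
      constructor
      · intro hk
        by_contra! hle
        have hsub : F i ⊆ Finset.Iio k := fun l hl => by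
          simp only [F, Finset.mem_filter, Finset.mem_univ, true_and] at hl
          rw [Finset.mem_Iio]
          by_contra! hkl
          have := Fin.le_def.1 (hmono k l hkl)
          omega
        have := Finset.card_le_card hsub
        rw [Fin.card_Iio] at this
        omega
      · intro hk
        have hsub : Finset.Iic k ⊆ F i := fun l hl => by
          simp only [F, Finset.mem_filter, Finset.mem_univ, true_and]
          have := Fin.le_def.1 (hmono l k (Finset.mem_Iic.1 hl))
          omega
        have := Finset.card_le_card hsub
        rw [Fin.card_Iic] at this
        omega
    refine ⟨fun i => (F i).card, by simp [F], by simp [F], fun i j hij => ?_, fun i => ?_⟩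
    · refine Finset.card_le_card fun k hk => ?_
      simp only [F, Finset.mem_filter, Finset.mem_univ, true_and] at hk ⊢
      exact hk.trans_le hij
    · ext n
      have h₁ := hF i (ρ n)
      have h₂ := hF (i + 1) (ρ n)
      rw [hσe] at h₁ h₂
      simp only [hσ, Finset.mem_biUnion, Finset.mem_filter, Finset.mem_univ, true_and, hρ,
        Fin.val_castSucc, Fin.val_succ]
      rw [Fin.ext_iff]
      constructor
      · intro hi
        exact ⟨ρ n, by omega, rfl⟩
      · rintro ⟨_, hk, rfl⟩
        omega

/-- Corollary 25: inclusion of closures of pieces of `B` corresponds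
to refinement of ordered partitions. -/
theorem stmt13 {d : ℕ} (hd : 1 ≤ d) (lam : Fin d → ℝ) (hlam : Function.Injective lam)
    {r r' : ℕ} (S : Fin r → Finset (Fin d)) (S' : Fin r' → Finset (Fin d))
    (hS : OrdPart S) (hS' : OrdPart S') :
    closure (Zset lam S) ⊆ closure (Zset lam S') ↔ Refines S S' := by
  obtain ⟨ρ, hρ⟩ := hS.exists_index
  obtain ⟨ρ', hρ'⟩ := hS'.exists_index
  rw [refines_iff hS.1 hρ hρ']
  constructor
  · intro hsub i j hij
    have hu : ∀ _ : Fin d, (0 : ℝ) < 1 := fun _ => one_pos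
    have hw := hsub (subset_closure (weightFamily_mem_Zset hρ hlam hu))
    by_contra hlt
    let T : NES d := ⟨{i, j}, i, by simp⟩
    have hclosed : IsClosed {w : Ew d | w T i = 0} :=
      isClosed_eq (by fun_prop) continuous_const
    have hzero : Zset lam S' ⊆ {w : Ew d | w T i = 0} := fun w hw => by
      by_contra h
      have := mem_argminOn.1 ((((mem_Zset_iff hρ').1 hw).2 T i).1 h)
      exact hlt (this.2 j (by simp [T]))
    refine (weightFamily_ne_zero_iff hlam hu T i).2 ?_ (closure_minimal hzero hclosed hw)
    simp [mem_argminOn, T, hij]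
  · intro h
    refine closure_minimal (fun w hw => ?_) isClosed_closure
    obtain ⟨u, hu, rfl⟩ := exists_eq_weightFamily hρ hlam hw
    refine mem_closure_of_tendsto (tendsto_weightFamily hlam hu h) ?_
    filter_upwards [self_mem_nhdsWithin] with ε hε
    exact weightFamily_mem_Zset hρ' hlam fun n => mul_pos (pow_pos hε _) (hu n)
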